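/- Let n ∈ ℕ with n ≥ 2, ℓ ∈ ℕ₀, α ∈ ℝ, R ∈ (0,∞), and consider on (0,R) the differential expression τ⁰_{n,ℓ,α} = −(d/dr) r^α (d/dr) + [ (n−1)(n−3+2α)/4 + ℓ(ℓ+n−2) ]·r^(α−2). Then τ⁰_{n,ℓ,α} is in the limit point case at r = 0 if and only if α ≥ 2 − n/2 − (2/n)·ℓ(ℓ+n−2), and τ⁰_{n,ℓ,α} is in the limit circle case at r = 0 if and only if α < 2 − n/2 − (2/n)·ℓ(ℓ+n−2). -/

import Mathlib

noncomputable section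

open MeasureTheory Set
open scoped ENNReal NNReal

/-- `(u, v)` is a (complex-valued) solution of `τ u = z u` on `(0, R)`, where
`τ = -(d/dx) x^α (d/dx) + Q(x)` and `v` plays the role of the quasi-derivative `x^α u'`. -/
def IsSolutionC (R : ℝ) (α : ℝ) (Q : ℝ → ℝ) (z : ℂ) (u v : ℝ → ℂ) : Prop :=
  ∀ x ∈ Ioo (0 : ℝ) R, ∀ x₀ ∈ Ioo (0 : ℝ) R,
    (u x = u x₀ + ∫ t in x₀..x, ((t ^ (-α) : ℝ) : ℂ) * v t) ∧
    (v x = v x₀ + ∫ t in x₀..x, ((Q t : ℂ) - z) * u t)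

/-- `(u, v)` is a real-valued solution of `τ u = λ u` on `(0, R)`. -/
def IsSolutionR (R : ℝ) (α : ℝ) (Q : ℝ → ℝ) (lam : ℝ) (u v : ℝ → ℝ) : Prop :=
  ∀ x ∈ Ioo (0 : ℝ) R, ∀ x₀ ∈ Ioo (0 : ℝ) R,
    (u x = u x₀ + ∫ t in x₀..x, (t ^ (-α)) * v t) ∧
    (v x = v x₀ + ∫ t in x₀..x, (Q t - lam) * u t)

/-- `τ` is in the limit point case at `x = 0`. -/
def LimitPointAtZero (R : ℝ) (α : ℝ) (Q : ℝ → ℝ) : Prop :=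
  ∀ z : ℂ, ∃ u v : ℝ → ℂ, IsSolutionC R α Q z u v ∧
    ∃ c ∈ Ioo (0 : ℝ) R, (∫⁻ x in Ioo (0 : ℝ) c, (‖u x‖₊ : ℝ≥0∞) ^ 2) = ⊤

/-- `τ` is in the limit circle case at `x = 0`. -/
def LimitCircleAtZero (R : ℝ) (α : ℝ) (Q : ℝ → ℝ) : Prop :=
  ∀ z : ℂ, ∀ u v : ℝ → ℂ, IsSolutionC R α Q z u v →
    ∃ c ∈ Ioo (0 : ℝ) R, (∫⁻ x in Ioo (0 : ℝ) c, (‖u x‖₊ : ℝ≥0∞) ^ 2) < ⊤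

/-- `τ` is nonoscillatory at `x = 0`. -/
def NonoscillatoryAtZero (R : ℝ) (α : ℝ) (Q : ℝ → ℝ) : Prop :=
  ∃ u v : ℝ → ℝ, IsSolutionR R α Q 0 u v ∧ (¬ ∀ x ∈ Ioo (0 : ℝ) R, u x = 0 ∧ v x = 0) ∧
    ∃ c ∈ Ioo (0 : ℝ) R, {x ∈ Ioo (0 : ℝ) c | u x = 0}.Finite

/-- Iterated logarithms: `iterLog 1 x = ln (1/x)`, `iterLog (j+1) x = ln (iterLog j x)`. -/
def iterLog : ℕ → ℝ → ℝ
  | 0, x => 1 / x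
  | j + 1, x => Real.log (iterLog j x)

/-- Global existence for an initial value problem `y' = f t y` on `ℝ` whose right-hand side
vanishes at `y = 0` and is Lipschitz in `y` with a constant depending continuously on `t`. The
contraction is taken in a norm weighted by `cosh (2 ∫₀ᵗ a)`. -/
theorem exists_global_solution {E : Type*} [NormedAddCommGroup E] [NormedSpace ℝ E]
    [CompleteSpace E] (f : ℝ → E → E) (hf : Continuous (Function.uncurry f))
    (a : ℝ → ℝ) (ha : Continuous a) (ha0 : ∀ t, 0 ≤ a t)
    (hfa : ∀ t x y, ‖f t x - f t y‖ ≤ a t * ‖x - y‖)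
    (hf0 : ∀ t, f t 0 = 0) (y₀ : E) :
    ∃ y : ℝ → E, y 0 = y₀ ∧ ∀ t, HasDerivAt y (f t (y t)) t := by
  set M : ℝ → ℝ := fun t => ∫ s in (0 : ℝ)..t, a s with hM
  have hMd : ∀ t, HasDerivAt M (a t) t := fun t =>
    (ha.integral_hasStrictDerivAt 0 t).hasDerivAt
  have hMc : Continuous M := continuous_iff_continuousAt.2 fun t => (hMd t).continuousAt
  set w : ℝ → ℝ := fun t => Real.cosh (2 * M t) with hw
  have hwc : Continuous w := Real.continuous_cosh.comp (hMc.const_mul 2)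
  have hw1 : ∀ t, 1 ≤ w t := fun t => Real.one_le_cosh _
  have hw0 : ∀ t, 0 < w t := fun t => Real.cosh_pos _
  have hint : ∀ t, |∫ s in (0 : ℝ)..t, a s * w s| ≤ w t / 2 := by
    intro t
    have h1 : ∫ s in (0 : ℝ)..t, a s * w s = Real.sinh (2 * M t) / 2 - Real.sinh (2 * M 0) / 2 := by
      refine intervalIntegral.integral_eq_sub_of_hasDerivAt
        (f := fun t => Real.sinh (2 * M t) / 2) (fun x _ => ?_)
        ((ha.mul hwc).intervalIntegrable _ _)
      refine ((((hMd x).const_mul 2).sinh).div_const 2).congr_deriv ?_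
      simp only [hw]; ring
    have h0 : M 0 = 0 := by simp [hM]
    rw [h1, h0]
    simp only [mul_zero, Real.sinh_zero, zero_div, sub_zero]
    rw [abs_div, abs_two]
    have : |Real.sinh (2 * M t)| ≤ w t := by
      rw [abs_le, Real.sinh_eq, hw]
      simp only [Real.cosh_eq]
      constructor <;> nlinarith [Real.exp_pos (2 * M t), Real.exp_pos (-(2 * M t))]
    linarith
  have hcF : ∀ b : BoundedContinuousFunction ℝ E, Continuous fun s => f s (w s • b s) := fun b =>
    hf.comp (continuous_id.prodMk (hwc.smul b.continuous))
  have hcI : ∀ b : BoundedContinuousFunction ℝ E,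
      Continuous fun t => ∫ s in (0 : ℝ)..t, f s (w s • b s) := fun b =>
    continuous_iff_continuousAt.2 fun t =>
      ((hcF b).integral_hasStrictDerivAt 0 t).hasDerivAt.continuousAt
  have hest : ∀ (g : ℝ → E) (C : ℝ), 0 ≤ C → (∀ s, ‖g s‖ ≤ a s * (w s * C)) →
      ∀ t, ‖(w t)⁻¹ • ∫ s in (0 : ℝ)..t, g s‖ ≤ C / 2 := by
    intro g C hC hg t
    have h1 : ‖∫ s in (0 : ℝ)..t, g s‖ ≤ |∫ s in (0 : ℝ)..t, a s * (w s * C)| :=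
      intervalIntegral.norm_integral_le_abs_of_norm_le (Filter.Eventually.of_forall fun s => hg s)
        ((ha.mul (hwc.mul_const C)).intervalIntegrable _ _)
    have h2 : ∫ s in (0 : ℝ)..t, a s * (w s * C) = (∫ s in (0 : ℝ)..t, a s * w s) * C := by
      rw [← intervalIntegral.integral_mul_const]; simp only [mul_assoc]
    rw [h2, abs_mul, abs_of_nonneg hC] at h1
    have h3 := mul_le_mul_of_nonneg_right (hint t) hC
    rw [norm_smul, norm_inv, Real.norm_of_nonneg (hw0 t).le, inv_mul_le_iff₀ (hw0 t)]
    linarith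
  set T : BoundedContinuousFunction ℝ E → BoundedContinuousFunction ℝ E := fun b =>
    BoundedContinuousFunction.ofNormedAddCommGroup
      (fun t => (w t)⁻¹ • (y₀ + ∫ s in (0 : ℝ)..t, f s (w s • b s)))
      ((hwc.inv₀ fun t => (hw0 t).ne').smul (continuous_const.add (hcI b)))
      (‖y₀‖ + ‖b‖ / 2) (by
        intro t
        rw [smul_add]
        refine (norm_add_le _ _).trans (add_le_add ?_ (hest _ _ (norm_nonneg b) ?_ t))
        · rw [norm_smul, norm_inv, Real.norm_of_nonneg (hw0 t).le, inv_mul_le_iff₀ (hw0 t)]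
          exact le_mul_of_one_le_left (norm_nonneg _) (hw1 t)
        · intro s
          have h := hfa s (w s • b s) 0
          rw [hf0, sub_zero, sub_zero, norm_smul, Real.norm_of_nonneg (hw0 s).le] at h
          exact h.trans (mul_le_mul_of_nonneg_left
            (mul_le_mul_of_nonneg_left (b.norm_coe_le_norm s) (hw0 s).le) (ha0 s))) with hT
  have hTc : ContractingWith (1 / 2) T := by
    refine ⟨by norm_num, LipschitzWith.of_dist_le_mul fun b c => ?_⟩
    rw [BoundedContinuousFunction.dist_le (by positivity)]
    intro t
    have h1 : T b t - T c t =
        (w t)⁻¹ • ∫ s in (0 : ℝ)..t, (f s (w s • b s) - f s (w s • c s)) := by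
      rw [intervalIntegral.integral_sub ((hcF b).intervalIntegrable _ _)
        ((hcF c).intervalIntegrable _ _)]
      simp only [hT, BoundedContinuousFunction.coe_ofNormedAddCommGroup]
      rw [← smul_sub, add_sub_add_left_eq_sub]
    rw [dist_eq_norm, h1]
    refine (hest _ (dist b c) dist_nonneg (fun s => ?_) t).trans (le_of_eq ?_)
    · refine (hfa s _ _).trans (mul_le_mul_of_nonneg_left ?_ (ha0 s))
      rw [← smul_sub, norm_smul, Real.norm_of_nonneg (hw0 s).le, ← dist_eq_norm]
      exact mul_le_mul_of_nonneg_left (BoundedContinuousFunction.dist_coe_le_dist s) (hw0 s).le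
    · push_cast; ring
  set b := ContractingWith.fixedPoint T hTc
  have hb : T b = b := ContractingWith.fixedPoint_isFixedPt hTc
  have hy : ∀ t, w t • b t = y₀ + ∫ s in (0 : ℝ)..t, f s (w s • b s) := by
    intro t
    have h : T b t = (w t)⁻¹ • (y₀ + ∫ s in (0 : ℝ)..t, f s (w s • b s)) := rfl
    rw [hb] at h
    conv_lhs => rw [h]
    rw [smul_inv_smul₀ (hw0 t).ne']
  refine ⟨fun t => w t • b t, ?_, fun t => ?_⟩
  · exact (hy 0).trans (by simp)
  · have h := (((hcF b).integral_hasStrictDerivAt 0 t).hasDerivAt).const_add y₀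
    exact h.congr_of_eventuallyEq (Filter.Eventually.of_forall hy)

/-- Pointwise form of `IsSolutionC` on a set `s`: both functions are differentiable there. -/
def IsPointwiseSolution (s : Set ℝ) (α : ℝ) (Q : ℝ → ℝ) (z : ℂ) (u v : ℝ → ℂ) : Prop :=
  ∀ x ∈ s, HasDerivAt u (((x ^ (-α) : ℝ) : ℂ) * v x) x ∧ HasDerivAt v (((Q x : ℂ) - z) * u x) x

theorem IsPointwiseSolution.mono {s t : Set ℝ} {α : ℝ} {Q : ℝ → ℝ} {z : ℂ} {u v : ℝ → ℂ}
    (h : IsPointwiseSolution t α Q z u v) (hst : s ⊆ t) : IsPointwiseSolution s α Q z u v :=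
  fun x hx => h x (hst hx)

theorem intervalIntegrable_of_continuousOn_Ioo {R : ℝ} {f : ℝ → ℂ}
    (hf : ContinuousOn f (Ioo 0 R)) {a b : ℝ} (ha : a ∈ Ioo 0 R) (hb : b ∈ Ioo 0 R) :
    IntervalIntegrable f volume a b :=
  (hf.mono (ordConnected_Ioo.uIcc_subset ha hb)).intervalIntegrable

theorem hasDerivAt_of_eq_add_integral {R : ℝ} {u f : ℝ → ℂ} (hf : ContinuousOn f (Ioo 0 R))
    (h : ∀ x ∈ Ioo 0 R, ∀ x₀ ∈ Ioo 0 R, u x = u x₀ + ∫ t in x₀..x, f t) :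
    ∀ x ∈ Ioo 0 R, HasDerivAt u (f x) x := by
  intro x hx
  have hn : Ioo 0 R ∈ nhds x := isOpen_Ioo.mem_nhds hx
  have h1 := (intervalIntegral.integral_hasDerivAt_right
    (intervalIntegrable_of_continuousOn_Ioo hf hx hx)
    (hf.stronglyMeasurableAtFilter isOpen_Ioo x hx) (hf.continuousAt hn)).const_add (u x)
  refine h1.congr_of_eventuallyEq ?_
  filter_upwards [hn] with y hy using h y hy x hx

/-- No integrability of `f` is assumed: where it fails, the integrals vanish and `u` is
constant. -/
theorem continuousOn_of_eq_add_integral {R : ℝ} {u f : ℝ → ℂ}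
    (h : ∀ x ∈ Ioo 0 R, ∀ x₀ ∈ Ioo 0 R, u x = u x₀ + ∫ t in x₀..x, f t) :
    ContinuousOn u (Ioo 0 R) := by
  by_cases hI : ∀ a ∈ Ioo 0 R, ∀ b ∈ Ioo 0 R, IntervalIntegrable f volume a b
  · intro x hx
    obtain ⟨a, ha, hax⟩ := exists_between hx.1
    obtain ⟨b, hxb, hb⟩ := exists_between hx.2
    have haI : a ∈ Ioo 0 R := ⟨ha, hax.trans hx.2⟩
    have hbI : b ∈ Ioo 0 R := ⟨hx.1.trans hxb, hb⟩
    have h1 := intervalIntegral.continuousOn_primitive_interval' (hI a haI b hbI) left_mem_uIcc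
    rw [uIcc_of_le (hax.trans hxb).le] at h1
    have h2 := (h1.continuousAt (Icc_mem_nhds hax hxb)).const_add (u a)
    refine (h2.congr ?_).continuousWithinAt
    filter_upwards [isOpen_Ioo.mem_nhds hx] with y hy using (h y hy a haI).symm
  · push Not at hI
    obtain ⟨a, ha, b, hb, hab⟩ := hI
    have hc : ∀ x ∈ Ioo 0 R, u x = u a := by
      intro x hx
      have hz : ∀ c ∈ Ioo 0 R, ∀ d ∈ Ioo 0 R, ¬ IntervalIntegrable f volume c d → u d = u c := by
        intro c hc d hd hcd
        rw [h d hd c hc, intervalIntegral.integral_undef hcd, add_zero]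
      by_cases hax : IntervalIntegrable f volume a x
      · rw [← hz x hx b hb fun hxb => hab (hax.trans hxb), hz a ha b hb hab]
      · exact hz a ha x hx hax
    exact continuousOn_const.congr hc

theorem continuousOn_ofReal_rpow (R p : ℝ) :
    ContinuousOn (fun t : ℝ => ((t ^ p : ℝ) : ℂ)) (Ioo 0 R) :=
  Complex.continuous_ofReal.comp_continuousOn
    (continuousOn_id.rpow_const fun _ hx => Or.inl hx.1.ne')

theorem isSolutionC_iff_isPointwiseSolution {R α : ℝ} {Q : ℝ → ℝ} (hQ : ContinuousOn Q (Ioo 0 R))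
    (z : ℂ) (u v : ℝ → ℂ) :
    IsSolutionC R α Q z u v ↔ IsPointwiseSolution (Ioo 0 R) α Q z u v := by
  have hA := continuousOn_ofReal_rpow R (-α)
  have hB : ContinuousOn (fun t : ℝ => (Q t : ℂ) - z) (Ioo 0 R) :=
    (Complex.continuous_ofReal.comp_continuousOn hQ).sub continuousOn_const
  constructor
  · intro h
    have hu := continuousOn_of_eq_add_integral fun x hx x₀ hx₀ => (h x hx x₀ hx₀).1
    have hv := continuousOn_of_eq_add_integral fun x hx x₀ hx₀ => (h x hx x₀ hx₀).2
    exact fun x hx =>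
      ⟨hasDerivAt_of_eq_add_integral (hA.mul hv) (fun x hx x₀ hx₀ => (h x hx x₀ hx₀).1) x hx,
        hasDerivAt_of_eq_add_integral (hB.mul hu) (fun x hx x₀ hx₀ => (h x hx x₀ hx₀).2) x hx⟩
  · intro h x hx x₀ hx₀
    have hu : ContinuousOn u (Ioo 0 R) := fun y hy => (h y hy).1.continuousAt.continuousWithinAt
    have hv : ContinuousOn v (Ioo 0 R) := fun y hy => (h y hy).2.continuousAt.continuousWithinAt
    have hs := ordConnected_Ioo.uIcc_subset hx₀ hx
    rw [intervalIntegral.integral_eq_sub_of_hasDerivAt (fun y hy => (h y (hs hy)).1)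
        (intervalIntegrable_of_continuousOn_Ioo (hA.mul hv) hx₀ hx),
      intervalIntegral.integral_eq_sub_of_hasDerivAt (fun y hy => (h y (hs hy)).2)
        (intervalIntegrable_of_continuousOn_Ioo (hB.mul hu) hx₀ hx)]
    constructor <;> ring

/-- Solutions with prescribed Wronskian exist on the whole half-line, by the substitution
`x = exp s`. -/
theorem exists_fundamental_system (α : ℝ) {Q : ℝ → ℝ} (hQ : ContinuousOn Q (Ioi 0)) (z : ℂ) :
    ∃ φ vφ ψ vψ : ℝ → ℂ, IsPointwiseSolution (Ioi 0) α Q z φ vφ ∧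
      IsPointwiseSolution (Ioi 0) α Q z ψ vψ ∧ ∀ x ∈ Ioi (0 : ℝ), φ x * vψ x - vφ x * ψ x = 1 := by
  set A : ℝ → ℂ := fun s => ((Real.exp s * Real.exp s ^ (-α) : ℝ) : ℂ) with hA
  set B : ℝ → ℂ := fun s => (Real.exp s : ℂ) * ((Q (Real.exp s) : ℂ) - z) with hB
  have hAc : Continuous A := Complex.continuous_ofReal.comp
    (Real.continuous_exp.mul (Real.continuous_exp.rpow_const fun s => Or.inl (Real.exp_ne_zero s)))
  have hBc : Continuous B := (Complex.continuous_ofReal.comp Real.continuous_exp).mul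
    ((Complex.continuous_ofReal.comp
      (hQ.comp_continuous Real.continuous_exp fun s => Real.exp_pos s)).sub continuous_const)
  have hex := exists_global_solution (E := ℂ × ℂ) (fun s y => (A s * y.2, B s * y.1))
    (by unfold Function.uncurry; fun_prop) (fun s => ‖A s‖ + ‖B s‖) (by fun_prop)
    (fun s => by positivity)
    (fun s x y => by
      have h1 : ‖x.1 - y.1‖ ≤ ‖x - y‖ := norm_fst_le (x - y)
      have h2 : ‖x.2 - y.2‖ ≤ ‖x - y‖ := norm_snd_le (x - y)
      simp only [Prod.mk_sub_mk, ← mul_sub]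
      refine norm_prod_le_iff.2 ⟨?_, ?_⟩ <;> simp only [norm_mul, add_mul]
      · exact (mul_le_mul_of_nonneg_left h2 (norm_nonneg _)).trans
          (le_add_of_nonneg_right (by positivity))
      · exact (mul_le_mul_of_nonneg_left h1 (norm_nonneg _)).trans
          (le_add_of_nonneg_left (by positivity)))
    (fun s => by simp)
  obtain ⟨p, hp0, hp⟩ := hex (1, 0)
  obtain ⟨q, hq0, hq⟩ := hex (0, 1)
  have hsol : ∀ y : ℝ → ℂ × ℂ, (∀ t, HasDerivAt y (A t * (y t).2, B t * (y t).1) t) →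
      IsPointwiseSolution (Ioi 0) α Q z (fun x => (y (Real.log x)).1)
        (fun x => (y (Real.log x)).2) := by
    intro y hy x hx
    have hx0 : (x : ℂ) ≠ 0 := by exact_mod_cast (ne_of_gt hx)
    have h := (hy (Real.log x)).scomp x (Real.hasDerivAt_log (ne_of_gt hx))
    simp only [hA, hB, Real.exp_log hx] at h
    constructor
    · refine (hasFDerivAt_fst.comp_hasDerivAt x h).congr_deriv ?_
      simp [mul_assoc, hx0]
    · refine (hasFDerivAt_snd.comp_hasDerivAt x h).congr_deriv ?_
      simp [mul_assoc, hx0]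
  refine ⟨_, _, _, _, hsol p hp, hsol q hq, fun x _ => ?_⟩
  have hW : ∀ t, HasDerivAt (fun t => (p t).1 * (q t).2 - (p t).2 * (q t).1) 0 t := by
    intro t
    have p1 : HasDerivAt (fun t => (p t).1) _ t := hasFDerivAt_fst.comp_hasDerivAt t (hp t)
    have p2 : HasDerivAt (fun t => (p t).2) _ t := hasFDerivAt_snd.comp_hasDerivAt t (hp t)
    have q1 : HasDerivAt (fun t => (q t).1) _ t := hasFDerivAt_fst.comp_hasDerivAt t (hq t)
    have q2 : HasDerivAt (fun t => (q t).2) _ t := hasFDerivAt_snd.comp_hasDerivAt t (hq t)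
    refine ((p1.mul q2).sub (p2.mul q1)).congr_deriv ?_
    simp only [ContinuousLinearMap.coe_fst', ContinuousLinearMap.coe_snd']
    ring
  have h := is_const_of_deriv_eq_zero (fun t => (hW t).differentiableAt) (fun t => (hW t).deriv)
    (Real.log x) 0
  simpa [hp0, hq0] using h

theorem lintegral_nnnorm_sq_lt_top_iff {R c : ℝ} {u : ℝ → ℂ} (hu : ContinuousOn u (Ioo 0 R))
    (hc : c ≤ R) :
    (∫⁻ x in Ioo (0 : ℝ) c, (‖u x‖₊ : ℝ≥0∞) ^ 2) < ⊤ ↔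
      IntegrableOn (fun x => ‖u x‖ ^ 2) (Ioo 0 c) := by
  have hm : AEStronglyMeasurable (fun x => ‖u x‖ ^ 2) (volume.restrict (Ioo 0 c)) :=
    ((hu.mono (Ioo_subset_Ioo_right hc)).norm.pow 2).aestronglyMeasurable measurableSet_Ioo
  have he : ∀ x, ‖‖u x‖ ^ 2‖ₑ = (‖u x‖₊ : ℝ≥0∞) ^ 2 := fun x => by
    rw [enorm_pow, enorm_norm]; rfl
  simp only [IntegrableOn, Integrable, hm, true_and, HasFiniteIntegral, he]

theorem IsPointwiseSolution.continuousOn {s : Set ℝ} {α : ℝ} {Q : ℝ → ℝ} {z : ℂ} {u v : ℝ → ℂ}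
    (h : IsPointwiseSolution s α Q z u v) : ContinuousOn u s :=
  fun x hx => (h x hx).1.continuousAt.continuousWithinAt

/-- Weyl's alternative: if for one spectral parameter a fundamental system is square integrable
near `0`, then so are all solutions for every other spectral parameter. -/
theorem IsPointwiseSolution.integrableOn_norm_sq {R α c : ℝ} {Q : ℝ → ℝ} {z₁ z₂ W : ℂ}
    {φ vφ ψ vψ w vw : ℝ → ℂ} (hc : c ∈ Ioo 0 R)
    (hφ : IsPointwiseSolution (Ioo 0 R) α Q z₁ φ vφ)
    (hψ : IsPointwiseSolution (Ioo 0 R) α Q z₁ ψ vψ)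
    (hw : IsPointwiseSolution (Ioo 0 R) α Q z₂ w vw) (hW : W ≠ 0)
    (hWr : ∀ x ∈ Ioo 0 R, φ x * vψ x - vφ x * ψ x = W)
    (hφi : IntegrableOn (fun x => ‖φ x‖ ^ 2) (Ioo 0 c))
    (hψi : IntegrableOn (fun x => ‖ψ x‖ ^ 2) (Ioo 0 c)) :
    IntegrableOn (fun x => ‖w x‖ ^ 2) (Ioo 0 c) := by
  have hW0 : 0 < ‖W‖ := norm_pos_iff.2 hW
  set a : ℝ → ℂ := fun x => w x * vψ x - vw x * ψ x with ha
  set b : ℝ → ℂ := fun x => φ x * vw x - vφ x * w x with hb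
  set E : ℝ → ℝ := fun x => ‖a x‖ ^ 2 + ‖b x‖ ^ 2 with hE
  set G : ℝ → ℝ := fun x => ‖φ x‖ ^ 2 + ‖ψ x‖ ^ 2 with hG
  set k : ℝ := 2 * ‖z₂ - z₁‖ / ‖W‖ with hk
  have hk0 : 0 ≤ k := by positivity
  have had : ∀ x ∈ Ioo 0 R, HasDerivAt a ((z₂ - z₁) * w x * ψ x) x := fun x hx =>
    (((hw x hx).1.mul (hψ x hx).2).sub ((hw x hx).2.mul (hψ x hx).1)).congr_deriv (by ring)
  have hbd : ∀ x ∈ Ioo 0 R, HasDerivAt b (-((z₂ - z₁) * w x * φ x)) x := fun x hx =>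
    (((hφ x hx).1.mul (hw x hx).2).sub ((hφ x hx).2.mul (hw x hx).1)).congr_deriv (by ring)
  have hwn : ∀ x ∈ Ioo 0 R, ‖w x‖ * ‖W‖ ≤ ‖φ x‖ * ‖a x‖ + ‖ψ x‖ * ‖b x‖ := by
    intro x hx
    have h : w x * W = φ x * a x + ψ x * b x := by rw [← hWr x hx]; simp only [ha, hb]; ring
    rw [← norm_mul, h]
    exact (norm_add_le _ _).trans_eq (by simp only [norm_mul])
  have hGi : IntegrableOn G (Ioo 0 c) := hφi.add hψi
  have hGc : ContinuousOn G (Ioo 0 R) :=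
    (hφ.continuousOn.norm.pow 2).add (hψ.continuousOn.norm.pow 2)
  have hGI : ∀ x ∈ Ioo 0 R, IntervalIntegrable G volume c x := fun x hx =>
    (hGc.mono (ordConnected_Ioo.uIcc_subset hc hx)).intervalIntegrable
  have hPd : ∀ x ∈ Ioo 0 R, HasDerivAt (fun x => ∫ t in c..x, G t) (G x) x := fun x hx =>
    intervalIntegral.integral_hasDerivAt_right (hGI x hx)
      (hGc.stronglyMeasurableAtFilter isOpen_Ioo x hx)
      (hGc.continuousAt (isOpen_Ioo.mem_nhds hx))
  set H : ℝ → ℝ := fun x => E x * Real.exp (k * ∫ t in c..x, G t) with hH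
  have hEd : ∀ x ∈ Ioo 0 R, ∃ e, HasDerivAt E e x ∧ -(k * G x * E x) ≤ e := by
    intro x hx
    refine ⟨_, (had x hx).norm_sq.add (hbd x hx).norm_sq, ?_⟩
    have h1 := neg_le_of_abs_le (abs_real_inner_le_norm (a x) ((z₂ - z₁) * w x * ψ x))
    have h2 := neg_le_of_abs_le (abs_real_inner_le_norm (b x) (-((z₂ - z₁) * w x * φ x)))
    rw [norm_neg] at h2
    simp only [norm_mul] at h1 h2
    have h3 : ‖z₂ - z₁‖ = k * ‖W‖ / 2 := by rw [hk]; field_simp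
    have h4 : ‖w x‖ * ‖W‖ * (‖a x‖ * ‖ψ x‖ + ‖b x‖ * ‖φ x‖) ≤ G x * E x := by
      refine (mul_le_mul_of_nonneg_right (hwn x hx) (by positivity)).trans ?_
      simp only [hG, hE]
      nlinarith [mul_nonneg (add_nonneg (sq_nonneg ‖φ x‖) (sq_nonneg ‖ψ x‖))
          (sq_nonneg (‖a x‖ - ‖b x‖)),
        mul_nonneg (add_nonneg (sq_nonneg ‖a x‖) (sq_nonneg ‖b x‖))
          (sq_nonneg (‖φ x‖ - ‖ψ x‖))]
    have h5 := mul_le_mul_of_nonneg_left h4 hk0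
    rw [h3] at h1 h2
    nlinarith
  have hHd : ∀ x ∈ Ioo 0 R, ∃ h, HasDerivAt H h x ∧ 0 ≤ h := by
    intro x hx
    obtain ⟨e, he, hle⟩ := hEd x hx
    refine ⟨_, he.mul ((hPd x hx).const_mul k).exp, ?_⟩
    have := mul_nonneg (by linarith : 0 ≤ e + k * G x * E x)
      (Real.exp_pos (k * ∫ t in c..x, G t)).le
    linarith
  have hmono : MonotoneOn H (Ioo 0 R) := by
    refine monotoneOn_of_deriv_nonneg (convex_Ioo 0 R) (fun x hx => ?_) ?_ ?_
    · obtain ⟨h, hd, -⟩ := hHd x hx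
      exact hd.continuousAt.continuousWithinAt
    · rw [interior_Ioo]
      intro x hx
      obtain ⟨h, hd, -⟩ := hHd x hx
      exact hd.differentiableAt.differentiableWithinAt
    · rw [interior_Ioo]
      intro x hx
      obtain ⟨h, hd, h0⟩ := hHd x hx
      rwa [hd.deriv]
  set I : ℝ := ∫ t in Ioo 0 c, G t
  have hEb : ∀ x ∈ Ioo 0 c, E x ≤ E c * Real.exp (k * I) := by
    intro x hx
    have hxR : x ∈ Ioo 0 R := ⟨hx.1, hx.2.trans hc.2⟩
    have h1 : E x * Real.exp (k * ∫ t in c..x, G t) ≤ E c := by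
      simpa [hH] using hmono hxR hc hx.2.le
    have h2 : ∫ t in x..c, G t ≤ I := by
      rw [intervalIntegral.integral_of_le hx.2.le, integral_Ioc_eq_integral_Ioo]
      exact setIntegral_mono_set hGi (Filter.Eventually.of_forall fun t => by
        simp only [hG, Pi.zero_apply]; positivity) (Ioo_subset_Ioo_left hx.1.le).eventuallyLE
    rw [intervalIntegral.integral_symm, mul_neg, Real.exp_neg, ← div_eq_mul_inv,
      div_le_iff₀ (Real.exp_pos _)] at h1
    refine h1.trans (mul_le_mul_of_nonneg_left ?_ (by simp only [hE]; positivity))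
    exact Real.exp_le_exp.2 (mul_le_mul_of_nonneg_left h2 hk0)
  refine Integrable.mono' (hGi.const_mul (E c * Real.exp (k * I) / ‖W‖ ^ 2))
    (((hw.continuousOn.mono (Ioo_subset_Ioo_right hc.2.le)).norm.pow 2).aestronglyMeasurable
      measurableSet_Ioo) ?_
  filter_upwards [ae_restrict_mem measurableSet_Ioo] with x hx
  have hxR : x ∈ Ioo 0 R := ⟨hx.1, hx.2.trans hc.2⟩
  rw [Real.norm_of_nonneg (by positivity), div_mul_eq_mul_div, le_div_iff₀ (by positivity),
    ← mul_pow]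
  have h1 : (‖w x‖ * ‖W‖) ^ 2 ≤ (‖φ x‖ * ‖a x‖ + ‖ψ x‖ * ‖b x‖) ^ 2 :=
    pow_le_pow_left₀ (by positivity) (hwn x hxR) 2
  have h2 : (‖φ x‖ * ‖a x‖ + ‖ψ x‖ * ‖b x‖) ^ 2 ≤ E x * G x := by
    simp only [hE, hG]
    nlinarith [sq_nonneg (‖φ x‖ * ‖b x‖ - ‖ψ x‖ * ‖a x‖)]
  exact h1.trans (h2.trans (mul_le_mul_of_nonneg_right (hEb x hx)
    (by simp only [hG]; positivity)))

theorem not_limitPointAtZero_of_limitCircleAtZero {R α : ℝ} {Q : ℝ → ℝ}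
    (hQ : ContinuousOn Q (Ioo 0 R)) (h : LimitCircleAtZero R α Q) :
    ¬ LimitPointAtZero R α Q := by
  intro hp
  obtain ⟨u, v, hu, c, hc, hct⟩ := hp 0
  obtain ⟨d, hd, hdt⟩ := h 0 u v hu
  have hcont := ((isSolutionC_iff_isPointwiseSolution hQ 0 u v).1 hu).continuousOn
  rw [lintegral_nnnorm_sq_lt_top_iff hcont hd.2.le] at hdt
  refine hct.not_lt ((lintegral_nnnorm_sq_lt_top_iff hcont hc.2.le).2 ?_)
  have h2 : IntegrableOn (fun x => ‖u x‖ ^ 2) (Icc d c) :=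
    ((hcont.mono fun x hx => ⟨hd.1.trans_le hx.1, hx.2.trans_lt hc.2⟩).norm.pow
      2).integrableOn_Icc
  refine (hdt.union h2).mono_set fun x hx => ?_
  rcases lt_or_ge x d with h | h
  · exact Or.inl ⟨hx.1, h⟩
  · exact Or.inr ⟨h, hx.2.le⟩

theorem isPointwiseSolution_ofReal {s : Set ℝ} {α : ℝ} {Q u v : ℝ → ℝ}
    (h : ∀ x ∈ s, HasDerivAt u (x ^ (-α) * v x) x ∧ HasDerivAt v (Q x * u x) x) :
    IsPointwiseSolution s α Q 0 (fun x => (u x : ℂ)) (fun x => (v x : ℂ)) := fun x hx =>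
  ⟨(h x hx).1.ofReal_comp.congr_deriv (by push_cast; ring),
    (h x hx).2.ofReal_comp.congr_deriv (by push_cast; ring)⟩

theorem isPointwiseSolution_rpow {α K p : ℝ} (hp : p * (p + α - 1) = K) :
    IsPointwiseSolution (Ioi 0) α (fun r => K * r ^ (α - 2)) 0
      (fun x => ((x ^ p : ℝ) : ℂ)) (fun x => ((p * x ^ (p + α - 1) : ℝ) : ℂ)) := by
  refine isPointwiseSolution_ofReal fun x (hx : 0 < x) => ⟨?_, ?_⟩
  · refine (Real.hasDerivAt_rpow_const (Or.inl hx.ne')).congr_deriv ?_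
    rw [mul_left_comm, ← Real.rpow_add hx]
    ring_nf
  · refine ((Real.hasDerivAt_rpow_const (Or.inl hx.ne')).const_mul p).congr_deriv ?_
    rw [mul_assoc K, ← Real.rpow_add hx, ← hp]
    ring_nf

theorem isPointwiseSolution_rpow_mul_log {α K p : ℝ} (hp : p * (p + α - 1) = K)
    (h2 : 2 * p = 1 - α) :
    IsPointwiseSolution (Ioi 0) α (fun r => K * r ^ (α - 2)) 0
      (fun x => ((x ^ p * Real.log x : ℝ) : ℂ))
      (fun x => (((p * Real.log x + 1) * x ^ (p + α - 1) : ℝ) : ℂ)) := by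
  refine isPointwiseSolution_ofReal fun x (hx : 0 < x) => ⟨?_, ?_⟩
  · refine ((Real.hasDerivAt_rpow_const (Or.inl hx.ne')).mul
      (Real.hasDerivAt_log hx.ne')).congr_deriv ?_
    rw [mul_left_comm, ← Real.rpow_add hx, show -α + (p + α - 1) = p - 1 by ring,
      Real.rpow_sub_one hx.ne']
    field_simp
  · refine ((((Real.hasDerivAt_log hx.ne').const_mul p).add_const 1).mul
      (Real.hasDerivAt_rpow_const (Or.inl hx.ne'))).congr_deriv ?_
    rw [show K * x ^ (α - 2) * (x ^ p * Real.log x) = K * (x ^ (α - 2) * x ^ p) * Real.log x by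
      ring, ← Real.rpow_add hx, ← hp,
      show α - 2 + p = p + α - 1 - 1 by ring, Real.rpow_sub_one hx.ne' (p + α - 1)]
    generalize x ^ (p + α - 1) = y
    field_simp
    linear_combination y * h2

theorem integrableOn_norm_rpow_sq_iff {c p : ℝ} (hc : 0 < c) :
    IntegrableOn (fun x : ℝ => ‖((x ^ p : ℝ) : ℂ)‖ ^ 2) (Ioo 0 c) ↔ -1 / 2 < p := by
  have h : EqOn (fun x : ℝ => ‖((x ^ p : ℝ) : ℂ)‖ ^ 2) (fun x : ℝ => x ^ (2 * p)) (Ioo 0 c) := by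
    intro x hx
    simp only [Complex.norm_real, Real.norm_eq_abs, sq_abs]
    rw [mul_comm, Real.rpow_mul hx.1.le, Real.rpow_two]
  rw [integrableOn_congr_fun h measurableSet_Ioo, intervalIntegral.integrableOn_Ioo_rpow_iff hc]
  constructor <;> intro h <;> linarith

theorem integrableOn_norm_rpow_mul_log_sq {c p : ℝ} (hc : 0 < c) (hc1 : c ≤ 1)
    (hp : -1 / 2 < p) :
    IntegrableOn (fun x : ℝ => ‖((x ^ p * Real.log x : ℝ) : ℂ)‖ ^ 2) (Ioo 0 c) := by
  set t : ℝ := (2 * p + 1) / 4 with ht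
  have ht0 : 0 < t := by rw [ht]; linarith
  have hi := ((integrableOn_norm_rpow_sq_iff (p := p - t) hc).2 (by rw [ht]; linarith)).const_mul
    ((1 / t) ^ 2)
  refine hi.mono' ?_ ?_
  · refine ContinuousOn.aestronglyMeasurable ?_ measurableSet_Ioo
    refine ((Complex.continuous_ofReal.comp_continuousOn ?_).norm).pow 2
    exact (continuousOn_id.rpow_const fun x hx => Or.inl hx.1.ne').mul
      (Real.continuousOn_log.mono fun x hx => hx.1.ne')
  · filter_upwards [ae_restrict_mem measurableSet_Ioo] with x hx
    have h1 := Real.abs_log_mul_self_rpow_lt x t hx.1 (hx.2.le.trans hc1) ht0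
    have h2 : x ^ p * Real.log x = x ^ (p - t) * (Real.log x * x ^ t) := by
      rw [mul_left_comm, ← Real.rpow_add hx.1, sub_add_cancel, mul_comm]
    rw [Real.norm_of_nonneg (by positivity), h2, Complex.norm_real, Complex.norm_real, norm_mul,
      mul_pow, mul_comm]
    exact mul_le_mul_of_nonneg_right (pow_le_pow_left₀ (norm_nonneg _) h1.le 2) (by positivity)

theorem continuousOn_const_mul_rpow (K p : ℝ) :
    ContinuousOn (fun r : ℝ => K * r ^ p) (Ioi 0) :=
  continuousOn_const.mul (continuousOn_id.rpow_const fun _ hx => Or.inl (ne_of_gt hx))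

theorem limitCircleAtZero_of_lt {R α K D : ℝ} (hR : 0 < R) (hD : 0 ≤ D)
    (hK : 4 * K = D ^ 2 - (1 - α) ^ 2) (h : D < 2 - α) :
    LimitCircleAtZero R α (fun r => K * r ^ (α - 2)) := by
  intro z w vw hw
  have hsub : Ioo 0 R ⊆ Ioi (0 : ℝ) := Ioo_subset_Ioi_self
  have hQ := (continuousOn_const_mul_rpow K (α - 2)).mono hsub
  rw [isSolutionC_iff_isPointwiseSolution hQ] at hw
  set c : ℝ := min 1 (R / 2) with hc
  have hc0 : 0 < c := lt_min one_pos (half_pos hR)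
  have hcR : c < R := (min_le_right _ _).trans_lt (half_lt_self hR)
  refine ⟨c, ⟨hc0, hcR⟩, (lintegral_nnnorm_sq_lt_top_iff hw.continuousOn hcR.le).2 ?_⟩
  have hφ := isPointwiseSolution_rpow (α := α) (K := K) (p := (1 - α - D) / 2) (by linarith)
  have hφi := (integrableOn_norm_rpow_sq_iff (p := (1 - α - D) / 2) hc0).2 (by linarith)
  rcases hD.eq_or_lt with rfl | hD0
  · have hψ := isPointwiseSolution_rpow_mul_log (α := α) (K := K) (p := (1 - α - 0) / 2)
      (by linarith) (by ring)
    refine (hφ.mono hsub).integrableOn_norm_sq ⟨hc0, hcR⟩ (hψ.mono hsub) hw one_ne_zero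
      (fun x hx => ?_) hφi
      (integrableOn_norm_rpow_mul_log_sq hc0 (min_le_left _ _) (by linarith))
    have h1 : x ^ ((1 - α - 0) / 2) * x ^ ((1 - α - 0) / 2 + α - 1) = 1 := by
      rw [← Real.rpow_add hx.1, ← Real.rpow_zero x]; ring_nf
    norm_cast
    linear_combination h1
  · have hψ := isPointwiseSolution_rpow (α := α) (K := K) (p := (1 - α + D) / 2) (by linarith)
    refine (hφ.mono hsub).integrableOn_norm_sq ⟨hc0, hcR⟩ (hψ.mono hsub) hw
      (W := (D : ℂ)) (by exact_mod_cast hD0.ne') (fun x hx => ?_) hφi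
      ((integrableOn_norm_rpow_sq_iff hc0).2 (by linarith))
    have h1 : x ^ ((1 - α - D) / 2) * x ^ ((1 - α + D) / 2 + α - 1) = 1 := by
      rw [← Real.rpow_add hx.1, ← Real.rpow_zero x]; ring_nf
    have h2 : x ^ ((1 - α - D) / 2 + α - 1) * x ^ ((1 - α + D) / 2) = 1 := by
      rw [← Real.rpow_add hx.1, ← Real.rpow_zero x]; ring_nf
    norm_cast
    linear_combination (1 - α + D) / 2 * h1 - (1 - α - D) / 2 * h2

theorem limitPointAtZero_of_le {R α K D : ℝ} (hR : 0 < R)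
    (hK : 4 * K = D ^ 2 - (1 - α) ^ 2) (h : 2 - α ≤ D) :
    LimitPointAtZero R α (fun r => K * r ^ (α - 2)) := by
  intro z
  have hQ := continuousOn_const_mul_rpow K (α - 2)
  have hsub : Ioo 0 R ⊆ Ioi (0 : ℝ) := Ioo_subset_Ioi_self
  obtain ⟨φ, vφ, ψ, vψ, hφ, hψ, hW⟩ := exists_fundamental_system α hQ z
  replace hφ := hφ.mono hsub
  replace hψ := hψ.mono hsub
  have hc : R / 2 ∈ Ioo 0 R := ⟨half_pos hR, half_lt_self hR⟩
  by_contra! hcon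
  have hL2 : ∀ u v, IsPointwiseSolution (Ioo 0 R) α (fun r => K * r ^ (α - 2)) z u v →
      IntegrableOn (fun x => ‖u x‖ ^ 2) (Ioo 0 (R / 2)) := fun u v hu =>
    (lintegral_nnnorm_sq_lt_top_iff hu.continuousOn hc.2.le).1 (lt_top_iff_ne_top.2
      (hcon u v ((isSolutionC_iff_isPointwiseSolution (hQ.mono hsub) z u v).2 hu) _ hc))
  have hw := isPointwiseSolution_rpow (α := α) (K := K) (p := (1 - α - D) / 2) (by linarith)
  have hi := hφ.integrableOn_norm_sq hc hψ (hw.mono hsub) one_ne_zero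
    (fun x hx => hW x (hsub hx)) (hL2 _ _ hφ) (hL2 _ _ hψ)
  have := (integrableOn_norm_rpow_sq_iff hc.1).1 hi
  linarith

theorem statement12 (n : ℕ) (hn : 2 ≤ n) (l : ℕ) (α : ℝ) (R : ℝ) (hR : 0 < R) :
    (LimitPointAtZero R α
        (fun r : ℝ =>
          (((n : ℝ) - 1) * ((n : ℝ) - 3 + 2 * α) / 4 + (l : ℝ) * ((l : ℝ) + (n : ℝ) - 2)) *
            r ^ (α - 2)) ↔
      2 - (n : ℝ) / 2 - (2 / (n : ℝ)) * (l : ℝ) * ((l : ℝ) + (n : ℝ) - 2) ≤ α) ∧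
    (LimitCircleAtZero R α
        (fun r : ℝ =>
          (((n : ℝ) - 1) * ((n : ℝ) - 3 + 2 * α) / 4 + (l : ℝ) * ((l : ℝ) + (n : ℝ) - 2)) *
            r ^ (α - 2)) ↔
      α < 2 - (n : ℝ) / 2 - (2 / (n : ℝ)) * (l : ℝ) * ((l : ℝ) + (n : ℝ) - 2)) := by
  set L : ℝ := (l : ℝ) * ((l : ℝ) + (n : ℝ) - 2) with hL
  set K : ℝ := ((n : ℝ) - 1) * ((n : ℝ) - 3 + 2 * α) / 4 + L with hKdef
  have hn2 : (2 : ℝ) ≤ n := by exact_mod_cast hn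
  have hL0 : 0 ≤ L := mul_nonneg (Nat.cast_nonneg l) (by
    have : (0 : ℝ) ≤ l := Nat.cast_nonneg l
    linarith)
  have hnn : 0 ≤ (α + n - 2) ^ 2 + 4 * L := by positivity
  set D : ℝ := √((α + n - 2) ^ 2 + 4 * L) with hDdef
  have hD0 : 0 ≤ D := Real.sqrt_nonneg _
  have hD2 : D ^ 2 = (α + n - 2) ^ 2 + 4 * L := Real.sq_sqrt hnn
  have hK : 4 * K = D ^ 2 - (1 - α) ^ 2 := by rw [hD2, hKdef]; ring
  set thr : ℝ := 2 - (n : ℝ) / 2 - (2 / (n : ℝ)) * (l : ℝ) * ((l : ℝ) + (n : ℝ) - 2) with hthr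
  have hthr' : 2 * n * (α - thr) = D ^ 2 - (2 - α) ^ 2 := by
    rw [hD2, hthr, hL]
    field_simp
    ring
  have hn0 : (0 : ℝ) < 2 * n := by linarith
  have hthr2 : thr < 2 := by
    have : 0 ≤ 2 / (n : ℝ) * L := by positivity
    rw [hthr, mul_assoc, ← hL]
    linarith
  have hpoint : thr ≤ α → LimitPointAtZero R α (fun r => K * r ^ (α - 2)) := fun h =>
    limitPointAtZero_of_le hR hK (by
      refine (le_abs_self _).trans (abs_le_of_sq_le_sq ?_ hD0)
      nlinarith)
  have hcircle : α < thr → LimitCircleAtZero R α (fun r => K * r ^ (α - 2)) := fun h =>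
    limitCircleAtZero_of_lt hR hD0 hK (by
      refine lt_of_pow_lt_pow_left₀ 2 (by linarith) ?_
      nlinarith)
  have hexcl : LimitCircleAtZero R α (fun r => K * r ^ (α - 2)) →
      ¬ LimitPointAtZero R α (fun r => K * r ^ (α - 2)) :=
    not_limitPointAtZero_of_limitCircleAtZero
      ((continuousOn_const_mul_rpow K (α - 2)).mono Ioo_subset_Ioi_self)
  refine ⟨⟨fun h => ?_, hpoint⟩, ⟨fun h => ?_, hcircle⟩⟩
  · by_contra! hlt
    exact hexcl (hcircle hlt) h
  · by_contra! hle
    exact hexcl h (hpoint hle)
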